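/- Let X be a random vector in ℝ^d with pdf f_X, let q be a quantizer with quantization regions S_i and reconstruction values x̂_i satisfying E[‖X − q(X)‖^r] ≤ D, let κ, η > 0, set ε = (D/κ)^{1/r}, let I = { i : Λ_{i,ε} ≥ η·V_d·ε^d }, and define the pdf f^{(Λ)}(x) = (P(X ∈ B_{i,ε})/Λ_{i,ε}) for x ∈ B_{i,ε} with i ∈ I, and f^{(Λ)}(x) = f_X(x) otherwise. Then ∑_i P(X ∈ B_{i,ε}) · Λ_{i,ε}^{r/d} / D ≤ V_d^{r/d}(1 + r/d) · ( 1 + (1/κ) ∫ | f^{(Λ)}(x) − f_X(x) | dx ) + η^{r/d} · V_d^{r/d} / κ. -/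

import Mathlib

open MeasureTheory Filter Set
open scoped ENNReal Topology ProbabilityTheory Pointwise

noncomputable section

/-- `N` is a norm on `ℝ^d`. -/
structure IsNorm {d : ℕ} (N : (Fin d → ℝ) → ℝ) : Prop where
  nonneg : ∀ x, 0 ≤ N x
  eq_zero_iff : ∀ x, N x = 0 ↔ x = 0
  smul : ∀ (c : ℝ) (x : Fin d → ℝ), N (c • x) = |c| * N x
  triangle : ∀ x y, N (x + y) ≤ N x + N y

/-- Lebesgue volume `V_d` of the unit ball of the norm `N`. -/
def unitBallVol {d : ℕ} (N : (Fin d → ℝ) → ℝ) : ℝ :=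
  (volume {x : Fin d → ℝ | N x ≤ 1}).toReal

/-- A (symbol-wise) quantizer: countably many disjoint Borel quantization regions `S i`
covering the space, with reconstruction values `c i`. -/
structure Quantizer (E : Type*) [MeasurableSpace E] where
  S : ℤ → Set E
  c : ℤ → E
  meas : ∀ i, MeasurableSet (S i)
  disj : Pairwise (Function.onFun Disjoint S)
  cover : ⋃ i, S i = Set.univ

/-- Expected `r`-th power distortion `E[‖X - q(X)‖^r]` of a quantizer, for a source with law `μ`
and norm `N`. -/
def Quantizer.distortion {E : Type*} [MeasurableSpace E] [Sub E] (q : Quantizer E)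
    (μ : Measure E) (N : E → ℝ) (r : ℝ) : ℝ≥0∞ :=
  ∑' i, ∫⁻ x in q.S i, ENNReal.ofReal (N (x - q.c i) ^ r) ∂μ

/-- Output entropy `H(q(X)) = -∑ pᵢ log pᵢ` of a quantizer (as an extended nonneg. real). -/
def Quantizer.entropy {E : Type*} [MeasurableSpace E] (q : Quantizer E) (μ : Measure E) : ℝ≥0∞ :=
  ∑' i, ENNReal.ofReal (Real.negMulLog (μ (q.S i)).toReal)

/-- Output entropy `H(q(X)) = -∑ pᵢ log pᵢ` of a quantizer (as a real number). -/
def Quantizer.entropyR {E : Type*} [MeasurableSpace E] (q : Quantizer E) (μ : Measure E) : ℝ :=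
  ∑' i, Real.negMulLog (μ (q.S i)).toReal

open scoped Classical in
/-- Kullback-Leibler divergence between two measures. -/
def klDiv {α : Type*} [MeasurableSpace α] (μ ν : Measure α) : ℝ≥0∞ :=
  if μ ≪ ν ∧ Integrable (fun x => Real.log (μ.rnDeriv ν x).toReal) μ
  then ENNReal.ofReal (∫ x, Real.log (μ.rnDeriv ν x).toReal ∂μ)
  else ⊤

/-- Mutual information of a joint law `π`, i.e. the KL divergence of `π` from the product of
its marginals. -/
def mutualInfo {α β : Type*} [MeasurableSpace α] [MeasurableSpace β]
    (π : Measure (α × β)) : ℝ≥0∞ :=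
  klDiv π ((π.map Prod.fst).prod (π.map Prod.snd))

/-- The rate-distortion function `R(D)`: the infimum of the mutual information `I(X; X̂)` over
all Markov kernels `P_{X̂|X}` with expected `r`-th power distortion at most `D`. -/
def RDfun {E : Type*} [MeasurableSpace E] [Sub E] (μ : Measure E) (N : E → ℝ) (r D : ℝ) :
    ℝ≥0∞ :=
  ⨅ (κ : ProbabilityTheory.Kernel E E) (_ : ProbabilityTheory.IsMarkovKernel κ)
    (_ : ∫⁻ p, ENNReal.ofReal (N (p.1 - p.2) ^ r) ∂(μ.compProd κ) ≤ ENNReal.ofReal D),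
    mutualInfo (μ.compProd κ)

/-- The smallest output entropy `R_{r,d}(D)` of a quantizer with `r`-th power distortion
at most `D`. -/
def RQfun {E : Type*} [MeasurableSpace E] [Sub E] (μ : Measure E) (N : E → ℝ) (r D : ℝ) :
    ℝ≥0∞ :=
  ⨅ (q : Quantizer E) (_ : q.distortion μ N r ≤ ENNReal.ofReal D), q.entropy μ

/-- The asymptotic excess rate `ℛ = liminf_{D ↓ 0} (R_{r,d}(D) - R(D))`. -/
def excessRate {E : Type*} [MeasurableSpace E] [Sub E] (μ : Measure E) (N : E → ℝ) (r : ℝ) :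
    ℝ :=
  Filter.liminf (fun D => (RQfun μ N r D).toReal - (RDfun μ N r D).toReal) (𝓝[>] (0:ℝ))

/-- The upper incomplete Gamma function `Γ(s, a) = ∫_a^∞ ξ^(s-1) e^(-ξ) dξ`. -/
def uGamma (s a : ℝ) : ℝ := ∫ ξ in Set.Ioi a, ξ ^ (s - 1) * Real.exp (-ξ)

/-- The part of the quantization cell `S i` within distance `ε` of the reconstruction point. -/
def Bcell {E : Type*} [MeasurableSpace E] [Sub E] (q : Quantizer E) (N : E → ℝ) (ε : ℝ)
    (i : ℤ) : Set E :=
  {x | x ∈ q.S i ∧ N (x - q.c i) ≤ ε}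


namespace IsNorm

variable {d : ℕ} {N : (Fin d → ℝ) → ℝ}

theorem convexOn (hN : IsNorm N) : ConvexOn ℝ univ N := by
  refine ⟨convex_univ, fun x _ y _ a b ha hb _ => (hN.triangle _ _).trans ?_⟩
  rw [hN.smul, hN.smul, abs_of_nonneg ha, abs_of_nonneg hb, smul_eq_mul, smul_eq_mul]

theorem continuous (hN : IsNorm N) : Continuous N :=
  continuousOn_univ.1 (hN.convexOn.continuousOn isOpen_univ)

theorem exists_mul_norm_le (hN : IsNorm N) : ∃ m > 0, ∀ x, m * ‖x‖ ≤ N x := by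
  rcases (Metric.sphere (0 : Fin d → ℝ) 1).eq_empty_or_nonempty with h | h
  · refine ⟨1, one_pos, fun x => ?_⟩
    have hx : x = 0 := by
      by_contra hx
      have : ‖x‖⁻¹ • x ∈ Metric.sphere (0 : Fin d → ℝ) 1 := by
        simp [norm_smul, norm_ne_zero_iff.2 hx]
      simp [h] at this
    simpa [hx] using hN.nonneg 0
  · obtain ⟨z, hz, hmin⟩ := (isCompact_sphere (0 : Fin d → ℝ) 1).exists_isMinOn h
      hN.continuous.continuousOn
    have hz0 : z ≠ 0 := by
      rintro rfl
      simp at hz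
    refine ⟨N z, (hN.nonneg z).lt_of_ne fun h0 => hz0 ((hN.eq_zero_iff z).1 h0.symm), fun x => ?_⟩
    rcases eq_or_ne x 0 with rfl | hx
    · simpa using hN.nonneg 0
    · have hx' := norm_pos_iff.2 hx
      have hmem : ‖x‖⁻¹ • x ∈ Metric.sphere (0 : Fin d → ℝ) 1 := by
        simp [norm_smul, hx'.ne']
      have hle : N z ≤ N (‖x‖⁻¹ • x) := hmin hmem
      rwa [hN.smul, abs_of_pos (inv_pos.2 hx'), inv_mul_eq_div, le_div_iff₀ hx'] at hle

theorem volume_unitBall_ne_top (hN : IsNorm N) : volume {x | N x ≤ 1} ≠ ⊤ := by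
  obtain ⟨m, hm, h⟩ := hN.exists_mul_norm_le
  refine ((measure_mono fun x (hx : N x ≤ 1) => ?_).trans_lt
    (measure_closedBall_lt_top (x := (0 : Fin d → ℝ)) (r := 1 / m))).ne
  rw [mem_closedBall_zero_iff, le_div_iff₀ hm, mul_comm]
  exact (h x).trans hx

theorem unitBallVol_pos (hN : IsNorm N) : 0 < unitBallVol N := by
  refine ENNReal.toReal_pos (fun h0 => ?_) hN.volume_unitBall_ne_top
  have hopen : IsOpen {x | N x < 1} := isOpen_lt hN.continuous continuous_const
  have hne : {x | N x < 1}.Nonempty := ⟨0, by simp [(hN.eq_zero_iff 0).2 rfl]⟩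
  exact (hopen.measure_pos volume hne).ne' (measure_mono_null
    (fun x (hx : N x < 1) => show N x ≤ 1 from hx.le) h0)

theorem volume_closedBall (hN : IsNorm N) (hd : 0 < d) (c : Fin d → ℝ) {s : ℝ} (hs : 0 ≤ s) :
    volume {x | N (x - c) ≤ s} = ENNReal.ofReal (unitBallVol N * s ^ d) := by
  have hshift : {x | N (x - c) ≤ s} = (fun x => x + -c) ⁻¹' {x | N x ≤ s} := by
    ext x
    simp [sub_eq_add_neg]
  rw [hshift, measure_preimage_add_right]
  rcases hs.eq_or_lt with rfl | hs
  · have : {x | N x ≤ 0} = {0} := by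
      ext x
      simp [← hN.eq_zero_iff, (hN.nonneg x).ge_iff_eq']
    have : Nonempty (Fin d) := ⟨⟨0, hd⟩⟩
    simp [*, hd.ne']
  · have hscale : {x | N x ≤ s} = s • {x | N x ≤ 1} := by
      ext x
      rw [mem_smul_set_iff_inv_smul_mem₀ hs.ne', mem_ofPred_eq, mem_ofPred_eq, hN.smul,
        abs_of_pos (inv_pos.2 hs), inv_mul_le_one₀ hs]
    rw [hscale, Measure.addHaar_smul, mul_comm, ENNReal.ofReal_mul hN.unitBallVol_pos.le,
      unitBallVol, ENNReal.ofReal_toReal hN.volume_unitBall_ne_top, abs_of_pos (by positivity)]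
    simp

theorem measurable_rpow (hN : IsNorm N) (c : Fin d → ℝ) (r : ℝ) :
    Measurable fun x => N (x - c) ^ r :=
  (hN.continuous.measurable.comp (measurable_id.sub_const c)).pow_const r

/-- The superlevel sets of `N (· - c) ^ r` in `B` have at least the measure of `B` minus that of
a ball. -/
theorem sub_le_volume_superlevel (hN : IsNorm N) (hd : 0 < d) {r : ℝ} (hr : 0 < r)
    {B : Set (Fin d → ℝ)} (hBfin : volume B ≠ ⊤) (c : Fin d → ℝ)
    {t : ℝ} (ht : 0 ≤ t) :
    ENNReal.ofReal ((volume B).toReal - unitBallVol N * t ^ ((d : ℝ) / r)) ≤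
      volume.restrict B {x | t < N (x - c) ^ r} := by
  have hV := hN.unitBallVol_pos
  have hball : volume {x | N (x - c) ≤ t ^ (1 / r)} =
      ENNReal.ofReal (unitBallVol N * t ^ ((d : ℝ) / r)) := by
    rw [hN.volume_closedBall hd c (by positivity), ← Real.rpow_mul_natCast ht]
    congr 3
    ring
  rw [ENNReal.ofReal_sub _ (by positivity), ENNReal.ofReal_toReal hBfin, ← hball,
    Measure.restrict_apply (measurableSet_lt measurable_const (hN.measurable_rpow c r))]
  refine le_measure_sdiff.trans (measure_mono fun x hx => ⟨?_, hx.1⟩)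
  have h1 : t ^ (1 / r) < N (x - c) := not_le.1 hx.2
  rw [one_div] at h1
  exact (Real.rpow_inv_lt_iff_of_pos ht (hN.nonneg _) hr).1 h1

/-- Among sets of given volume, balls minimize the `r`-th moment. -/
theorem volume_rpow_le_lintegral (hN : IsNorm N) (hd : 0 < d) {r : ℝ} (hr : 0 < r)
    {B : Set (Fin d → ℝ)} (hBfin : volume B ≠ ⊤) (c : Fin d → ℝ) :
    ENNReal.ofReal ((volume B).toReal * (volume B).toReal ^ (r / (d : ℝ))) ≤
      ENNReal.ofReal (unitBallVol N ^ (r / (d : ℝ)) * (1 + r / (d : ℝ))) *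
        ∫⁻ x in B, ENNReal.ofReal (N (x - c) ^ r) := by
  have hd' : (0 : ℝ) < d := Nat.cast_pos.2 hd
  have hV := hN.unitBallVol_pos
  set V := unitBallVol N with hVdef
  set L := (volume B).toReal with hL
  have hL0 : 0 ≤ L := ENNReal.toReal_nonneg
  set T := (L / V) ^ (r / (d : ℝ)) with hT
  have hT0 : 0 ≤ T := by positivity
  have hint : IntervalIntegrable (fun t : ℝ => L - V * t ^ ((d : ℝ) / r)) volume 0 T :=
    intervalIntegrable_const.sub
      ((intervalIntegral.intervalIntegrable_rpow (Or.inl (by positivity))).const_mul V)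
  have hTpow : T ^ ((d : ℝ) / r) = L / V := by
    rw [hT, ← Real.rpow_mul (by positivity), div_mul_div_cancel₀ hd'.ne', div_self hr.ne',
      Real.rpow_one]
  have hval : ∫ t in (0 : ℝ)..T, (L - V * t ^ ((d : ℝ) / r)) = L * T / (1 + r / (d : ℝ)) := by
    rw [intervalIntegral.integral_sub intervalIntegrable_const
      ((intervalIntegral.intervalIntegrable_rpow (Or.inl (by positivity))).const_mul V),
      intervalIntegral.integral_const_mul, integral_rpow (Or.inl (by
        have : 0 < (d : ℝ) / r := by positivity
        linarith)), Real.rpow_add_one' hT0 (by positivity), hTpow,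
      Real.zero_rpow (by positivity), intervalIntegral.integral_const, smul_eq_mul]
    field_simp
    ring
  have hnonneg : ∀ t ∈ Ioc 0 T, 0 ≤ L - V * t ^ ((d : ℝ) / r) := by
    intro t ht
    have : t ^ ((d : ℝ) / r) ≤ L / V :=
      hTpow ▸ Real.rpow_le_rpow ht.1.le ht.2 (by positivity)
    rw [le_div_iff₀ hV] at this
    linarith
  have hmoment : ENNReal.ofReal (L * T / (1 + r / (d : ℝ))) ≤
      ∫⁻ x in B, ENNReal.ofReal (N (x - c) ^ r) := by
    rw [lintegral_eq_lintegral_meas_lt _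
      (ae_of_all _ fun x => Real.rpow_nonneg (hN.nonneg _) r)
      (hN.measurable_rpow c r).aemeasurable, ← hval, intervalIntegral.integral_of_le hT0,
      ofReal_integral_eq_lintegral_ofReal hint.1
        ((ae_restrict_iff' measurableSet_Ioc).2 (ae_of_all _ hnonneg))]
    refine (setLIntegral_mono' measurableSet_Ioc fun t ht => ?_).trans
      (lintegral_mono_set Ioc_subset_Ioi_self)
    exact hN.sub_le_volume_superlevel hd hr hBfin c ht.1.le
  calc ENNReal.ofReal (L * L ^ (r / (d : ℝ)))
      = ENNReal.ofReal (V ^ (r / (d : ℝ)) * (1 + r / (d : ℝ))) *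
          ENNReal.ofReal (L * T / (1 + r / (d : ℝ))) := by
        rw [← ENNReal.ofReal_mul (by positivity), hT, Real.div_rpow hL0 hV.le]
        congr 1
        field_simp
    _ ≤ _ := by gcongr

end IsNorm

theorem measurableSet_Bcell {d : ℕ} {N : (Fin d → ℝ) → ℝ} (hN : IsNorm N)
    (q : Quantizer (Fin d → ℝ)) (ε : ℝ) (i : ℤ) : MeasurableSet (Bcell q N ε i) :=
  (q.meas i).inter (measurableSet_le
    (hN.continuous.measurable.comp (measurable_id.sub_const _)) measurable_const)

theorem volume_Bcell_ne_top {d : ℕ} (hd : 0 < d) {N : (Fin d → ℝ) → ℝ} (hN : IsNorm N)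
    (q : Quantizer (Fin d → ℝ)) {ε : ℝ} (hε : 0 ≤ ε) (i : ℤ) : volume (Bcell q N ε i) ≠ ⊤ :=
  measure_ne_top_of_subset (fun _ hx => hx.2)
    (hN.volume_closedBall hd (q.c i) hε ▸ ENNReal.ofReal_ne_top)

theorem pairwise_disjoint_Bcell {d : ℕ} (N : (Fin d → ℝ) → ℝ) (q : Quantizer (Fin d → ℝ)) (ε : ℝ) :
    Pairwise (Function.onFun Disjoint (Bcell q N ε)) := fun _ _ hij =>
  (q.disj hij).mono (fun _ hx => hx.1) fun _ hx => hx.1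

/-- A function obtained from an integrable one by averaging its density over countably many
disjoint sets differs from it by an integrable function. -/
theorem integrable_sub_of_eq_average {α ι : Type*} [MeasurableSpace α] [Countable ι]
    {ν μ : Measure α} [IsFiniteMeasure μ] {f g : α → ℝ} (hfm : Measurable f) (hf0 : ∀ x, 0 ≤ f x)
    (hμf : μ = ν.withDensity fun x => ENNReal.ofReal (f x)) {B : ι → Set α}
    (hB : ∀ i, MeasurableSet (B i)) (hdisj : Pairwise (Function.onFun Disjoint B))
    (hpos : ∀ i, 0 < (ν (B i)).toReal)
    (hg1 : ∀ i, ∀ x ∈ B i, g x = (μ (B i)).toReal / (ν (B i)).toReal)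
    (hg2 : ∀ x, (∀ i, x ∉ B i) → g x = f x) : Integrable (fun x => g x - f x) ν := by
  have hf : Integrable f ν := by
    refine ⟨hfm.aestronglyMeasurable, ?_⟩
    rw [hasFiniteIntegral_iff_ofReal (ae_of_all _ hf0), ← setLIntegral_univ,
      ← withDensity_apply _ MeasurableSet.univ, ← hμf]
    exact measure_lt_top μ _
  set U := ⋃ i, B i with hU
  have hUm : MeasurableSet U := MeasurableSet.iUnion hB
  have hgm : Measurable g := by
    intro s hs
    have : g ⁻¹' s = (⋃ i, B i ∩ {_x | (μ (B i)).toReal / (ν (B i)).toReal ∈ s}) ∪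
        (Uᶜ ∩ f ⁻¹' s) := by
      ext x
      by_cases hx : x ∈ U
      · obtain ⟨i, hi⟩ := mem_iUnion.1 hx
        simp only [mem_preimage, mem_union, mem_iUnion, mem_inter_iff, mem_ofPred_eq, mem_compl_iff,
          hx, not_true_eq_false, false_and, or_false]
        exact ⟨fun h => ⟨i, hi, hg1 i x hi ▸ h⟩, fun ⟨j, hj, h⟩ => hg1 j x hj ▸ h⟩
      · have hx' : ∀ i, x ∉ B i := by simpa [hU] using hx
        simp [hx, hx', hg2 x hx']
    rw [this]
    exact (MeasurableSet.iUnion fun i => (hB i).inter (MeasurableSet.const _)).union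
      (hUm.compl.inter (hfm hs))
  have hgU : IntegrableOn g U ν := by
    refine ⟨hgm.aestronglyMeasurable, ?_⟩
    rw [hasFiniteIntegral_iff_enorm]
    calc ∫⁻ x in U, ‖g x‖ₑ ∂ν = ∑' i, ∫⁻ x in B i, ‖g x‖ₑ ∂ν := lintegral_iUnion hB hdisj _
      _ = ∑' i, μ (B i) := by
        refine tsum_congr fun i => ?_
        rw [setLIntegral_congr_fun (hB i) (g := fun _ => μ (B i) / ν (B i)), setLIntegral_const,
          ENNReal.div_mul_cancel]
        · exact fun h => (hpos i).ne' (by simp [h])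
        · exact fun h => (hpos i).ne' (by simp [h])
        · intro x hx
          simp only [hg1 i x hx]
          rw [← ENNReal.toReal_div, Real.enorm_of_nonneg ENNReal.toReal_nonneg,
            ENNReal.ofReal_toReal]
          exact ENNReal.div_ne_top (measure_ne_top μ _) fun h => (hpos i).ne' (by simp [h])
      _ = μ U := (measure_iUnion hdisj hB).symm
      _ < ⊤ := measure_lt_top μ _
  have hgUc : IntegrableOn g Uᶜ ν :=
    hf.integrableOn.congr_fun (fun x hx => (hg2 x (by simpa [hU] using hx)).symm) hUm.compl
  exact (integrableOn_univ.1 (union_compl_self U ▸ hgU.union hgUc)).sub hf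

/-- Eq. (77): bound on `∑ᵢ P(X ∈ B_{i,ε}) Λ_{i,ε}^{r/d} / D` in terms of
the `L¹` distance between the piecewise-constant density `f^{(Λ)}` and `f_X`. -/
theorem sum_cell_measures_le_of_L1 {d : ℕ} (hd : 0 < d) {r : ℝ} (hr : 0 < r)
    {N : (Fin d → ℝ) → ℝ} (hN : IsNorm N)
    (μ : Measure (Fin d → ℝ)) [IsProbabilityMeasure μ]
    (f : (Fin d → ℝ) → ℝ) (hfm : Measurable f) (hf0 : ∀ x, 0 ≤ f x)
    (hμf : μ = volume.withDensity fun x => ENNReal.ofReal (f x))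
    (q : Quantizer (Fin d → ℝ)) (D κ η : ℝ) (hD : 0 < D) (hκ : 0 < κ) (hη : 0 < η)
    (hdist : q.distortion μ N r ≤ ENNReal.ofReal D)
    (g : (Fin d → ℝ) → ℝ)
    (hg1 : ∀ i, η * unitBallVol N * ((D / κ) ^ (1 / r)) ^ d
          ≤ (volume (Bcell q N ((D / κ) ^ (1 / r)) i)).toReal →
        ∀ x ∈ Bcell q N ((D / κ) ^ (1 / r)) i,
          g x = (μ (Bcell q N ((D / κ) ^ (1 / r)) i)).toReal
            / (volume (Bcell q N ((D / κ) ^ (1 / r)) i)).toReal)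
    (hg2 : ∀ x, (∀ i, η * unitBallVol N * ((D / κ) ^ (1 / r)) ^ d
          ≤ (volume (Bcell q N ((D / κ) ^ (1 / r)) i)).toReal →
        x ∉ Bcell q N ((D / κ) ^ (1 / r)) i) → g x = f x) :
    ∑' i : ℤ, μ (Bcell q N ((D / κ) ^ (1 / r)) i) *
        ENNReal.ofReal ((volume (Bcell q N ((D / κ) ^ (1 / r)) i)).toReal ^ (r / (d : ℝ)) / D)
      ≤ ENNReal.ofReal
          (unitBallVol N ^ (r / (d : ℝ)) * (1 + r / (d : ℝ))
              * (1 + (1 / κ) * ∫ x, |g x - f x|)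
            + η ^ (r / (d : ℝ)) * unitBallVol N ^ (r / (d : ℝ)) / κ) := by
  have hd' : (0 : ℝ) < d := Nat.cast_pos.2 hd
  have hV := hN.unitBallVol_pos
  set ε := (D / κ) ^ (1 / r) with hεdef
  have hε : 0 < ε := by positivity
  have hεr : ε ^ r = D / κ := by
    rw [hεdef, ← Real.rpow_mul (by positivity), one_div_mul_cancel hr.ne', Real.rpow_one]
  have hBm := measurableSet_Bcell hN q ε
  have hdisj := pairwise_disjoint_Bcell N q ε
  have hfin := volume_Bcell_ne_top hd hN q hε.le
  set B := Bcell q N ε with hBdef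
  set V := unitBallVol N with hVdef
  set s := r / (d : ℝ) with hs
  have hs0 : 0 < s := by positivity
  have hθ : 0 < η * V * ε ^ d := by positivity
  have hint : Integrable (fun x => g x - f x) volume := by
    refine integrable_sub_of_eq_average
      (ι := {i : ℤ // η * V * ε ^ d ≤ (volume (B i)).toReal}) (B := fun i => B i) hfm hf0 hμf
      (fun i => hBm i) (fun i j hij => hdisj (Subtype.coe_ne_coe.2 hij))
      (fun i => hθ.trans_le i.2) (fun i => hg1 i i.2) fun x hx => hg2 x fun i hi => hx ⟨i, hi⟩
  set C := V ^ s * (1 + s) with hC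
  have hC0 : 0 ≤ C := by positivity
  set K := η ^ s * V ^ s / κ with hK
  have hK0 : 0 ≤ K := by positivity
  have hlarge : ∀ i, η * V * ε ^ d ≤ (volume (B i)).toReal →
      μ (B i) * ENNReal.ofReal ((volume (B i)).toReal ^ s / D) ≤
        ENNReal.ofReal (C / D) * (∫⁻ x in B i, ENNReal.ofReal (N (x - q.c i) ^ r) ∂μ +
          ENNReal.ofReal (D / κ) * ∫⁻ x in B i, ENNReal.ofReal |g x - f x|) := by
    intro i hi
    have hL : 0 < (volume (B i)).toReal := hθ.trans_le hi
    set L := (volume (B i)).toReal with hLdef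
    set p := (μ (B i)).toReal with hp
    have hp0 : 0 ≤ p := ENNReal.toReal_nonneg
    have hNm := hN.measurable_rpow (q.c i) r
    calc μ (B i) * ENNReal.ofReal (L ^ s / D)
        = ENNReal.ofReal (p / L / D) * ENNReal.ofReal (L * L ^ s) := by
          rw [← ENNReal.ofReal_toReal (measure_ne_top μ (B i)), ← hp, ← ENNReal.ofReal_mul hp0,
            ← ENNReal.ofReal_mul (by positivity)]
          congr 1
          field_simp
      _ ≤ ENNReal.ofReal (p / L / D) * (ENNReal.ofReal C *
            ∫⁻ x in B i, ENNReal.ofReal (N (x - q.c i) ^ r)) := by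
          gcongr
          exact hN.volume_rpow_le_lintegral hd hr (hfin i) (q.c i)
      _ = ENNReal.ofReal (C / D) * ∫⁻ x in B i,
            ENNReal.ofReal (p / L) * ENNReal.ofReal (N (x - q.c i) ^ r) := by
          rw [lintegral_const_mul _ hNm.ennreal_ofReal, ← mul_assoc, ← mul_assoc,
            ← ENNReal.ofReal_mul (by positivity), ← ENNReal.ofReal_mul (by positivity)]
          congr 2
          field_simp
      _ ≤ ENNReal.ofReal (C / D) * ∫⁻ x in B i,
            (ENNReal.ofReal (f x) * ENNReal.ofReal (N (x - q.c i) ^ r) +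
              ENNReal.ofReal (D / κ) * ENNReal.ofReal |g x - f x|) := by
          gcongr ENNReal.ofReal (C / D) * ?_
          refine setLIntegral_mono' (hBm i) fun x hx => ?_
          have hpow : N (x - q.c i) ^ r ≤ D / κ :=
            hεr ▸ Real.rpow_le_rpow (hN.nonneg _) hx.2 hr.le
          have hpow0 : 0 ≤ N (x - q.c i) ^ r := Real.rpow_nonneg (hN.nonneg _) r
          rw [← hg1 i hi x hx, ← ENNReal.ofReal_mul' hpow0, ← ENNReal.ofReal_mul (hf0 x),
            ← ENNReal.ofReal_mul (by positivity),
            ← ENNReal.ofReal_add (mul_nonneg (hf0 x) hpow0) (by positivity)]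
          refine ENNReal.ofReal_le_ofReal ?_
          nlinarith [mul_le_mul_of_nonneg_right hpow (abs_nonneg (g x - f x)),
            mul_le_mul_of_nonneg_right (le_abs_self (g x - f x)) hpow0]
      _ = _ := by
          have hfN : Measurable fun x =>
              ENNReal.ofReal (f x) * ENNReal.ofReal (N (x - q.c i) ^ r) :=
            hfm.ennreal_ofReal.mul hNm.ennreal_ofReal
          rw [lintegral_add_left hfN,
            lintegral_const_mul' _ _ ENNReal.ofReal_ne_top, hμf,
            setLIntegral_withDensity_eq_setLIntegral_mul _ hfm.ennreal_ofReal
              hNm.ennreal_ofReal (hBm i)]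
          rfl
  have hsmall : ∀ i, (volume (B i)).toReal ≤ η * V * ε ^ d →
      μ (B i) * ENNReal.ofReal ((volume (B i)).toReal ^ s / D) ≤ μ (B i) * ENNReal.ofReal K := by
    intro i hi
    have hεd : (ε ^ d) ^ s = D / κ := by
      rw [← hεr, ← Real.rpow_natCast, ← Real.rpow_mul hε.le, hs, mul_div_cancel₀ _ hd'.ne']
    gcongr
    calc (volume (B i)).toReal ^ s / D ≤ (η * V * ε ^ d) ^ s / D := by gcongr
      _ = K := by
        rw [Real.mul_rpow (by positivity) (by positivity), Real.mul_rpow hη.le hV.le, hεd, hK]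
        field_simp
  calc ∑' i, μ (B i) * ENNReal.ofReal ((volume (B i)).toReal ^ s / D)
      ≤ ∑' i, (ENNReal.ofReal (C / D) * (∫⁻ x in B i, ENNReal.ofReal (N (x - q.c i) ^ r) ∂μ +
          ENNReal.ofReal (D / κ) * ∫⁻ x in B i, ENNReal.ofReal |g x - f x|) +
          μ (B i) * ENNReal.ofReal K) := by
        refine ENNReal.tsum_le_tsum fun i => ?_
        rcases le_total (η * V * ε ^ d) (volume (B i)).toReal with hi | hi
        · exact (hlarge i hi).trans le_self_add
        · exact (hsmall i hi).trans le_add_self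
    _ = ENNReal.ofReal (C / D) * (∑' i, ∫⁻ x in B i, ENNReal.ofReal (N (x - q.c i) ^ r) ∂μ +
          ENNReal.ofReal (D / κ) * ∫⁻ x in ⋃ i, B i, ENNReal.ofReal |g x - f x|) +
          μ (⋃ i, B i) * ENNReal.ofReal K := by
        rw [ENNReal.tsum_add, ENNReal.tsum_mul_left, ENNReal.tsum_add, ENNReal.tsum_mul_left,
          ENNReal.tsum_mul_right, lintegral_iUnion hBm hdisj, measure_iUnion hdisj hBm]
    _ ≤ ENNReal.ofReal (C / D) * (ENNReal.ofReal D +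
          ENNReal.ofReal (D / κ) * ENNReal.ofReal (∫ x, |g x - f x|)) +
          1 * ENNReal.ofReal K := by
        rw [ofReal_integral_eq_lintegral_ofReal hint.abs (ae_of_all _ fun x => abs_nonneg _)]
        gcongr
        · exact (ENNReal.tsum_le_tsum fun i => lintegral_mono_set fun x hx => hx.1).trans hdist
        · exact Measure.restrict_le_self
        · exact prob_le_one
    _ = _ := by
        have hJ : 0 ≤ ∫ x, |g x - f x| := integral_nonneg fun x => abs_nonneg _
        rw [one_mul, ← ENNReal.ofReal_mul (by positivity),
          ← ENNReal.ofReal_add hD.le (by positivity), ← ENNReal.ofReal_mul (by positivity),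
          ← ENNReal.ofReal_add (by positivity) hK0]
        congr 2
        field_simp

end
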